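/- Let (R,m,k) be a regular Noetherian local ring of dimension d ≥ 1. Then Ext^1_R(Ω^{d−1}_R k, R)^μ = 0; that is, every short exact sequence 0 → R → X → Ω^{d−1}_R k → 0 of finitely generated R-modules with μ(X) = μ(R) + μ(Ω^{d−1}_R k) = 1 + μ(Ω^{d−1}_R k) splits. -/

import Mathlib

open IsLocalRing

/-- The minimal number of generators `μ(M) = dim_k (M/𝔪M)` of a module over a local ring. -/
noncomputable def mu (R : Type) [CommRing R] [IsLocalRing R]
    (M : Type) [AddCommGroup M] [Module R M] : ℕ :=
  Module.finrank (R ⧸ maximalIdeal R)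
    (M ⧸ (maximalIdeal R • ⊤ : Submodule R M))

/-- A local ring is regular if its maximal ideal is generated by `dim R` elements. -/
def IsRegularLocal (R : Type) [CommRing R] [IsLocalRing R] : Prop :=
  ∃ (n : ℕ) (x : Fin n → R), Ideal.span (Set.range x) = maximalIdeal R ∧
    ringKrullDim R = n

/-- `S` is an `i`-th syzygy of the residue field `k` in a minimal free resolution. -/
def IsMinSyzygyOfResidueField (R : Type) [CommRing R] [IsLocalRing R] (i : ℕ)
    (S : Type) [AddCommGroup S] [Module R S] : Prop :=
  ∃ (b : ℕ → ℕ) (f : ∀ j : ℕ, ((Fin (b (j+1)) → R) →ₗ[R] (Fin (b j) → R)))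
    (ε : (Fin (b 0) → R) →ₗ[R] R ⧸ maximalIdeal R),
    Function.Surjective ε ∧
    Function.Exact (f 0) ε ∧
    (∀ j, Function.Exact (f (j+1)) (f j)) ∧
    LinearMap.ker ε ≤ (maximalIdeal R) • (⊤ : Submodule R (Fin (b 0) → R)) ∧
    (∀ j, LinearMap.range (f j) ≤ (maximalIdeal R) • (⊤ : Submodule R (Fin (b j) → R))) ∧
    ((i = 0 ∧ Nonempty (S ≃ₗ[R] R ⧸ maximalIdeal R)) ∨
      (∃ j, i = j + 1 ∧ Nonempty (S ≃ₗ[R] LinearMap.range (f j))))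

theorem aux_exists_y (R : Type) [CommRing R] [IsLocalRing R] [IsNoetherianRing R] (n : ℕ)
    (hd : ringKrullDim R = (n + 1 : ℕ)) :
    ∃ y ∈ maximalIdeal R, y ∉ maximalIdeal R ^ 2 ∧ ∀ P ∈ minimalPrimes R, y ∉ P := by
  have hnot : maximalIdeal R ∉ minimalPrimes R := by
    intro h
    have h0 : (maximalIdeal R).height = 0 := Ideal.height_eq_zero_iff.mpr h
    have := maximalIdeal_height_eq_ringKrullDim (R := R)
    rw [h0, hd] at this
    have h2 : ((0 : ℕ) : WithBot ℕ∞) = ((n+1 : ℕ) : WithBot ℕ∞) := by simpa using this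
    have := Nat.cast_injective h2
    omega
  by_contra hcon
  push Not at hcon
  have hfin : (insert (maximalIdeal R ^ 2) (minimalPrimes R)).Finite :=
    (minimalPrimes.finite_of_isNoetherianRing R).insert _
  have := (Ideal.subset_union_prime_finite hfin (f := id) (maximalIdeal R ^ 2)
    (maximalIdeal R ^ 2) (I := maximalIdeal R) (by
      rintro i (rfl | hi) h1 h2
      · exact absurd rfl h1
      · exact hi.1.1)).1 (by
      intro y hy
      by_cases h2 : y ∈ maximalIdeal R ^ 2
      · exact Set.mem_biUnion (Set.mem_insert _ _) h2
      · obtain ⟨P, hP, hyP⟩ := hcon y hy h2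
        exact Set.mem_biUnion (Set.mem_insert_of_mem _ hP) hyP)
  obtain ⟨I, rfl | hI, hle⟩ := this
  · have hbot : maximalIdeal R = ⊥ := by
      apply Submodule.eq_bot_of_le_smul_of_le_jacobson_bot (maximalIdeal R) _
        (IsNoetherian.noetherian _)
      · simpa [pow_two] using hle
      · exact maximalIdeal_le_jacobson _
    apply hnot
    refine ⟨⟨inferInstance, bot_le⟩, fun J hJ _ => ?_⟩
    rw [hbot]; exact bot_le
  · have : I.IsPrime := hI.1.1
    have : I = maximalIdeal R := le_antisymm (le_maximalIdeal this.ne_top) hle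
    exact hnot (this ▸ hI)

theorem aux_gens (R : Type) [CommRing R] [IsLocalRing R] (n : ℕ)
    (x : Fin (n+1) → R) (hx : Ideal.span (Set.range x) = maximalIdeal R)
    (y : R) (hy : y ∈ maximalIdeal R) (hy2 : y ∉ maximalIdeal R ^ 2) :
    ∃ i : Fin (n+1), ∀ j, x j ∈ Ideal.span {y} ⊔ Ideal.span (Set.range (x ∘ i.succAbove)) := by
  have hxm : ∀ i, x i ∈ maximalIdeal R := fun i => hx ▸ Ideal.subset_span ⟨i, rfl⟩
  rw [← hx, Ideal.mem_span_range_iff_exists_fun] at hy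
  obtain ⟨c, hc⟩ := hy
  have : ∃ i, IsUnit (c i) := by
    by_contra h
    push Not at h
    apply hy2
    rw [← hc, pow_two]
    exact Ideal.sum_mem _ fun i _ => Ideal.mul_mem_mul ((mem_maximalIdeal _).2 (h i)) (hxm i)
  obtain ⟨i, u, hu⟩ := this
  refine ⟨i, fun j => ?_⟩
  have hsucc : ∀ k, x (i.succAbove k) ∈
      Ideal.span {y} ⊔ Ideal.span (Set.range (x ∘ i.succAbove)) := fun k =>
    Ideal.mem_sup_right (Ideal.subset_span ⟨k, rfl⟩)
  induction j using Fin.succAboveCases i with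
  | x =>
    rw [Fin.sum_univ_succAbove _ i] at hc
    have : x i = (u⁻¹ : Rˣ) * (y - ∑ k, c (i.succAbove k) * x (i.succAbove k)) := by
      rw [← hc, ← hu]; simp
    rw [this]
    apply Ideal.mul_mem_left
    apply Ideal.sub_mem
    · exact Ideal.mem_sup_left (Ideal.mem_span_singleton_self y)
    · exact Ideal.sum_mem _ fun k _ => Ideal.mul_mem_left _ _ (hsucc k)
  | p k => exact hsucc k

open RingTheory.Sequence Pointwise in
theorem aux_reg (n : ℕ) : ∀ (R : Type) [CommRing R] [IsLocalRing R] [IsNoetherianRing R]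
    (x : Fin n → R), Ideal.span (Set.range x) = maximalIdeal R → ringKrullDim R = n →
    IsDomain R ∧ ∃ rs : List R, IsWeaklyRegular R rs ∧ Ideal.ofList rs = maximalIdeal R ∧
      rs.length = n := by
  induction n with
  | zero =>
    intro R _ _ _ x hx hd
    have hbot : maximalIdeal R = ⊥ := by rw [← hx]; simp
    refine ⟨?_, [], ?_, ?_, rfl⟩
    · exact (isField_iff_maximalIdeal_eq.2 hbot).isDomain
    · simp
    · simp [hbot]
  | succ n ih =>
    intro R _ _ _ x hx hd
    obtain ⟨y, hy, hy2, hyP⟩ := aux_exists_y R n hd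
    obtain ⟨i, hi⟩ := aux_gens R n x hx y hy hy2
    have hne : Ideal.span {y} ≠ ⊤ := by
      intro h
      rw [Ideal.span_singleton_eq_top] at h
      exact (mem_maximalIdeal _).1 hy h
    have : Nontrivial (R ⧸ Ideal.span {y}) := Ideal.Quotient.nontrivial_iff.2 hne
    have hsurj := Ideal.Quotient.mk_surjective (I := Ideal.span {y})
    have : IsLocalRing (R ⧸ Ideal.span {y}) := IsLocalRing.of_surjective' _ hsurj
    have hmap : (maximalIdeal R).map (Ideal.Quotient.mk (Ideal.span {y})) =
        maximalIdeal (R ⧸ Ideal.span {y}) :=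
      map_maximalIdeal_of_surjective _ hsurj
    have hcomap : (maximalIdeal (R ⧸ Ideal.span {y})).comap (Ideal.Quotient.mk (Ideal.span {y})) =
        maximalIdeal R := by
      rw [← hmap, Ideal.comap_map_of_surjective' _ hsurj, Ideal.mk_ker]
      exact sup_eq_left.2 ((Ideal.span_singleton_le_iff_mem _).2 hy)
    have hsm : Ideal.span {y} = y • (⊤ : Ideal R) := by
      simp [← Submodule.ideal_span_singleton_smul]
    have hdim : ringKrullDim (R ⧸ Ideal.span {y}) = n := by
      have := Module.supportDim_quotSMulTop_succ_eq_of_notMem_minimalPrimes_of_mem_maximalIdeal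
        (M := R) (x := y) (by
          have h0 : Module.annihilator R R = ⊥ :=
            Module.annihilator_eq_bot.mpr ((faithfulSMul_iff_algebraMap_injective R R).mpr fun {a₁ a₂} a ↦ a)
          rw [h0]; exact hyP) hy
      rw [Module.supportDim_self_eq_ringKrullDim, hd] at this
      have h2 : Module.supportDim R (QuotSMulTop y R) = ringKrullDim (R ⧸ Ideal.span {y}) := by
        rw [hsm]; exact Module.supportDim_quotient_eq_ringKrullDim _
      rw [h2] at this
      push_cast at this
      exact ENat.WithBot.add_one_cancel.1 this
    have hgen : Ideal.span (Set.range (Ideal.Quotient.mk (Ideal.span {y}) ∘ (x ∘ i.succAbove))) =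
        maximalIdeal (R ⧸ Ideal.span {y}) := by
      rw [Set.range_comp, ← Ideal.map_span, ← hmap]
      apply le_antisymm
      · apply Ideal.map_mono
        rw [← hx]
        apply Ideal.span_mono
        rintro _ ⟨k, rfl⟩; exact ⟨_, rfl⟩
      · have : maximalIdeal R ≤ Ideal.span {y} ⊔ Ideal.span (Set.range (x ∘ i.succAbove)) := by
          rw [← hx, Ideal.span_le]
          rintro _ ⟨j, rfl⟩
          exact hi j
        refine (Ideal.map_mono this).trans ?_
        rw [Ideal.map_sup]
        simp
    obtain ⟨hdom, rs, hrs, hof, hlen⟩ := ih (R ⧸ Ideal.span {y}) _ hgen hdim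
    have hprime : (Ideal.span {y}).IsPrime := (Ideal.Quotient.isDomain_iff_prime _).1 hdom
    have hdomR : IsDomain R := by
      obtain ⟨P, hP, hPy⟩ := Ideal.exists_minimalPrimes_le (I := ⊥) (J := Ideal.span {y}) bot_le
      have hyP' : y ∉ P := hyP P hP
      have hPp : P.IsPrime := hP.1.1
      have : P = ⊥ := by
        apply Submodule.eq_bot_of_le_smul_of_le_jacobson_bot (maximalIdeal R) _
          (IsNoetherian.noetherian _)
        · intro z hz
          obtain ⟨w, rfl⟩ := Ideal.mem_span_singleton'.1 (hPy hz)
          have hw : w ∈ P := (hPp.mem_or_mem hz).resolve_right hyP'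
          rw [mul_comm]
          exact Ideal.mul_mem_mul hy hw
        · exact maximalIdeal_le_jacobson _
      rw [this] at hPp
      exact IsDomain.of_bot_isPrime R
    refine ⟨hdomR, ?_⟩
    obtain ⟨rs', rfl⟩ : ∃ rs' : List R, rs'.map (Ideal.Quotient.mk (Ideal.span {y})) = rs :=
      List.map_surjective_iff.2 hsurj rs
    refine ⟨y :: rs', ?_, ?_, by simpa using hlen⟩
    · rw [isWeaklyRegular_cons_iff]
      constructor
      · have hy0 : y ≠ 0 := by
          rintro rfl; exact hy2 (zero_mem _)
        exact IsSMulRegular.of_ne_zero hy0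
      · have e : (QuotSMulTop y R) ≃ₗ[R] (R ⧸ Ideal.span {y}) :=
          Submodule.quotEquivOfEq _ _ hsm.symm
        rw [e.isWeaklyRegular_congr, ← isWeaklyRegular_map_algebraMap_iff (R ⧸ Ideal.span {y})]
        exact hrs
    · rw [Ideal.ofList_cons, ← hcomap, ← hof, ← Ideal.map_ofList,
        Ideal.comap_map_of_surjective' _ hsurj, Ideal.mk_ker, sup_comm]


open CategoryTheory in
theorem aux_pd_k (R : Type) [CommRing R] [IsLocalRing R] [IsNoetherianRing R] (n : ℕ)
    (rs : List R) (h : RingTheory.Sequence.IsWeaklyRegular R rs)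
    (hof : Ideal.ofList rs = maximalIdeal R) (hlen : rs.length = n) :
    HasProjectiveDimensionLT (ModuleCat.of R (R ⧸ maximalIdeal R)) (n + 1) := by
  have h1 := ModuleCat.projectiveDimension_quotient_eq_add_length_of_isWeaklyRegular
    (ModuleCat.of R R) rs h (by
      intro r hr
      rw [← hof]
      exact Ideal.subset_span hr)
  have h0 : projectiveDimension (ModuleCat.of R R) ≤ (0 : ℕ) := by
    rw [projectiveDimension_le_iff]
    exact (projective_iff_hasProjectiveDimensionLE_zero _).1 inferInstance
  have e : (R ⧸ Ideal.ofList rs • (⊤ : Submodule R R)) ≃ₗ[R] (R ⧸ maximalIdeal R) :=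
    Submodule.quotEquivOfEq _ _ (by simp [hof])
  have h2 := projectiveDimension_eq_of_iso e.toModuleIso
  have h3 : projectiveDimension (ModuleCat.of R (R ⧸ maximalIdeal R)) ≤ (n : ℕ) := by
    rw [← h2, ← hlen]
    refine h1.le.trans ?_
    refine (add_le_add_left h0 _).trans ?_
    simp
  exact (projectiveDimension_le_iff _ _).1 h3

open CategoryTheory in
/-- step: syzygies drop the projective dimension -/
theorem aux_pd_step (R : Type) [CommRing R] (P S K : Type) [AddCommGroup P] [AddCommGroup S]
    [AddCommGroup K] [Module R P] [Module R S] [Module R K] [Module.Projective R P]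
    (i : K →ₗ[R] P) (p : P →ₗ[R] S) (hi : Function.Injective i) (hp : Function.Surjective p)
    (hex : Function.Exact i p) (n : ℕ)
    (h : HasProjectiveDimensionLT (ModuleCat.of R S) (n + 2)) :
    HasProjectiveDimensionLT (ModuleCat.of R K) (n + 1) := by
  have hS := LinearMap.shortExact_shortComplexKer hp
  have h1 := (hS.hasProjectiveDimensionLT_X₃_iff n
    (inferInstanceAs (Projective (ModuleCat.of R P)))).1 h
  have e : (LinearMap.ker p) ≃ₗ[R] K :=
    (LinearEquiv.ofEq _ _ (LinearMap.exact_iff.1 hex)).trans (LinearEquiv.ofInjective i hi).symm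
  exact hasProjectiveDimensionLT_of_iso e.toModuleIso _

/-- Multiplication by `a` factoring through `P → S` extends to a map `P → K`. -/
theorem aux_tau (R : Type) [CommRing R] (P S K : Type) [AddCommGroup P] [AddCommGroup S]
    [AddCommGroup K] [Module R P] [Module R S] [Module R K]
    (i : K →ₗ[R] P) (p : P →ₗ[R] S) (hi : Function.Injective i)
    (hex : Function.Exact i p) (a : R) (σ : S →ₗ[R] P) (hσ : ∀ s, p (σ s) = a • s) :
    ∃ τ : P →ₗ[R] K, ∀ k, τ (i k) = a • k := by
  let δ : P →ₗ[R] P := a • LinearMap.id - σ ∘ₗ p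
  have hδ : ∀ x, δ x ∈ LinearMap.range i := by
    intro x
    rw [← LinearMap.exact_iff.1 hex, LinearMap.mem_ker]
    simp [δ, hσ]
  refine ⟨(LinearEquiv.ofInjective i hi).symm.toLinearMap ∘ₗ LinearMap.codRestrict _ δ hδ, ?_⟩
  intro k
  apply hi
  have h2 : p (i k) = 0 := hex.apply_apply_eq_zero k
  have : ∀ z : LinearMap.range i, i ((LinearEquiv.ofInjective i hi).symm z) = z := by
    intro z
    have := (LinearEquiv.ofInjective i hi).apply_symm_apply z
    exact congrArg Subtype.val this
  simp [this, δ, h2]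

/-- The final argument. -/
theorem aux_main (R : Type) [CommRing R] [IsLocalRing R]
    (P S K : Type) [AddCommGroup P] [AddCommGroup S]
    [AddCommGroup K] [Module R P] [Module R S] [Module R K] [Module.Projective R P]
    [Module.Projective R K] [Module.Finite R K]
    (i : K →ₗ[R] P) (p : P →ₗ[R] S) (hp : Function.Surjective p)
    (hex : Function.Exact i p)
    (hmin : LinearMap.range i ≤ maximalIdeal R • (⊤ : Submodule R P))
    (hτ : ∀ a ∈ maximalIdeal R, ∃ τ : P →ₗ[R] K, ∀ k, τ (i k) = a • k)
    (X : Type) [AddCommGroup X] [Module R X]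
    (f : R →ₗ[R] X) (g : X →ₗ[R] S)
    (hf : Function.Injective f) (hg : Function.Surjective g) (hfg : Function.Exact f g)
    (h1 : f 1 ∉ maximalIdeal R • (⊤ : Submodule R X)) :
    ∃ s : S →ₗ[R] X, g ∘ₗ s = LinearMap.id := by
  obtain ⟨l, hl⟩ := Module.projective_lifting_property g p hg
  have hl' : ∀ x, g (l x) = p x := fun x => LinearMap.congr_fun hl x
  have hr : ∀ k, (l ∘ₗ i) k ∈ LinearMap.range f := by
    intro k
    rw [← LinearMap.exact_iff.1 hfg, LinearMap.mem_ker]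
    simp [hl', hex.apply_apply_eq_zero k]
  have hinv : ∀ z : LinearMap.range f, f ((LinearEquiv.ofInjective f hf).symm z) = z := by
    intro z
    exact congrArg Subtype.val ((LinearEquiv.ofInjective f hf).apply_symm_apply z)
  let φ : K →ₗ[R] R :=
    (LinearEquiv.ofInjective f hf).symm.toLinearMap ∘ₗ LinearMap.codRestrict _ (l ∘ₗ i) hr
  have hφ : ∀ k, f (φ k) = l (i k) := by
    intro k; simp [φ, hinv]
  have hφm : ∀ k, φ k ∈ maximalIdeal R := by
    intro k
    rw [mem_maximalIdeal]
    intro hu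
    obtain ⟨u, hu⟩ := hu
    apply h1
    have h2 : l (i k) ∈ maximalIdeal R • (⊤ : Submodule R X) := by
      have h3 : l (i k) ∈ (maximalIdeal R • (⊤ : Submodule R P)).map l :=
        Submodule.mem_map_of_mem (hmin ⟨k, rfl⟩)
      rw [Submodule.map_smul''] at h3
      exact Submodule.smul_mono le_rfl le_top h3
    have h4 : f 1 = (u⁻¹ : Rˣ).val • l (i k) := by
      rw [← hφ, ← hu, ← map_smul]; simp
    rw [h4]
    exact Submodule.smul_mem _ _ h2
  -- extend φ
  obtain ⟨Φ, hΦ⟩ : ∃ Φ : P →ₗ[R] R, ∀ k, Φ (i k) = φ k := by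
    obtain ⟨n, q, t, hq, ht, hqt⟩ := Module.Finite.exists_comp_eq_id_of_projective R K
    choose τ hτ' using fun j : Fin n => hτ (φ (q (Pi.single j 1))) (hφm _)
    refine ⟨∑ j, LinearMap.proj j ∘ₗ t ∘ₗ τ j, fun k => ?_⟩
    have : φ k = φ (q (t k)) := by
      rw [show q (t k) = k from LinearMap.congr_fun hqt k]
    rw [this]
    have h5 := LinearMap.pi_apply_eq_sum_univ (φ ∘ₗ q) (t k)
    rw [LinearMap.comp_apply] at h5
    rw [h5, LinearMap.sum_apply]
    refine Finset.sum_congr rfl fun j _ => ?_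
    have h6 : (fun j' => if j = j' then (1 : R) else 0) = Pi.single j 1 := by
      ext j'; simp [Pi.single_apply, eq_comm]
    rw [h6]
    simp [hτ', mul_comm]
  let ψ : P →ₗ[R] X := l - f ∘ₗ Φ
  have hker : LinearMap.ker p ≤ LinearMap.ker ψ := by
    intro x hx
    obtain ⟨k, rfl⟩ := (hex x).1 hx
    simp [ψ, hΦ, hφ]
  let e := p.quotKerEquivOfSurjective hp
  refine ⟨(LinearMap.ker p).liftQ ψ hker ∘ₗ e.symm.toLinearMap, ?_⟩
  ext s
  obtain ⟨x, rfl⟩ := hp s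
  have : e.symm (p x) = Submodule.Quotient.mk x := by
    rw [LinearEquiv.symm_apply_eq]; rfl
  simp [this, ψ, hl', hfg.apply_apply_eq_zero]

theorem aux_mu (R : Type) [CommRing R] [IsLocalRing R] 
    (S : Type) [AddCommGroup S] [Module R S] [Module.Finite R S]
    (X : Type) [AddCommGroup X] [Module R X] 
    (f : R →ₗ[R] X) (g : X →ₗ[R] S)
    (hg : Function.Surjective g) (hfg : Function.Exact f g)
    (hmu : mu R X = mu R R + mu R S) :
    f 1 ∉ maximalIdeal R • (⊤ : Submodule R X) := by
  intro h1
  have hR : 0 < mu R R := by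
    have : Nontrivial (R ⧸ (maximalIdeal R • (⊤ : Submodule R R))) := by
      apply Submodule.Quotient.nontrivial_iff.2
      simpa using (Ideal.IsPrime.ne_top (I := maximalIdeal R) inferInstance)
    letI : Field (R ⧸ maximalIdeal R) := Ideal.Quotient.field _
    exact Module.finrank_pos (R := R ⧸ maximalIdeal R)
  have hmap : (maximalIdeal R • (⊤ : Submodule R X)).map g = maximalIdeal R • ⊤ := by
    rw [Submodule.map_smul'', Submodule.map_top, LinearMap.range_eq_top.2 hg]
  let G : (X ⧸ (maximalIdeal R • (⊤ : Submodule R X))) →ₗ[R]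
      (S ⧸ (maximalIdeal R • (⊤ : Submodule R S))) :=
    Submodule.mapQ _ _ g (Submodule.map_le_iff_le_comap.1 hmap.le)
  have hG : Function.Injective G := by
    rw [injective_iff_map_eq_zero]
    intro x hx
    obtain ⟨x, rfl⟩ := Submodule.Quotient.mk_surjective _ x
    have hx' : g x ∈ (maximalIdeal R • (⊤ : Submodule R X)).map g := by
      rw [hmap]
      exact (Submodule.Quotient.mk_eq_zero _).1 hx
    obtain ⟨x', hx'm, hxx'⟩ := hx'
    obtain ⟨r, hr⟩ := (hfg (x - x')).1 (by rw [map_sub, hxx', sub_self])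
    rw [Submodule.Quotient.mk_eq_zero]
    have : x = r • f 1 + x' := by
      rw [← map_smul, smul_eq_mul, mul_one, hr]; simp
    rw [this]
    exact add_mem (Submodule.smul_mem _ _ h1) hx'm
  let G' : (X ⧸ (maximalIdeal R • (⊤ : Submodule R X))) →ₗ[R ⧸ maximalIdeal R]
      (S ⧸ (maximalIdeal R • (⊤ : Submodule R S))) :=
    LinearMap.extendScalarsOfSurjective (R := R) Ideal.Quotient.mk_surjective G
  have hle : mu R X ≤ mu R S := by
    letI : Field (R ⧸ maximalIdeal R) := Ideal.Quotient.field _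
    exact LinearMap.finrank_le_finrank_of_injective (f := G') hG
  omega

theorem aux_res (R : Type) [CommRing R] [IsLocalRing R] [IsNoetherianRing R] (b : ℕ → ℕ)
    (f : ∀ j : ℕ, ((Fin (b (j+1)) → R) →ₗ[R] (Fin (b j) → R)))
    (ε : (Fin (b 0) → R) →ₗ[R] R ⧸ maximalIdeal R)
    (hε : Function.Surjective ε) (h0 : Function.Exact (f 0) ε)
    (hf : ∀ j, Function.Exact (f (j+1)) (f j)) (n m : ℕ)
    (hpd : CategoryTheory.HasProjectiveDimensionLT (ModuleCat.of R (R ⧸ maximalIdeal R))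
      (n + m + 2)) :
    (CategoryTheory.HasProjectiveDimensionLT (ModuleCat.of R (LinearMap.range (f n))) (m + 1)) ∧
    ∀ a ∈ maximalIdeal R, ∃ τ : (Fin (b n) → R) →ₗ[R] LinearMap.range (f n),
      ∀ k, τ ((LinearMap.range (f n)).subtype k) = a • k := by
  induction n generalizing m with
  | zero =>
    have hex : Function.Exact (LinearMap.range (f 0)).subtype ε := by
      rw [LinearMap.exact_iff, Submodule.range_subtype]; exact LinearMap.exact_iff.1 h0
    constructor
    · rw [Nat.zero_add] at hpd
      exact aux_pd_step R _ _ _ _ ε (Submodule.subtype_injective _) hε hex m hpd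
    · intro a ha
      refine aux_tau R _ _ _ _ ε (Submodule.subtype_injective _) hex a 0 ?_
      intro s
      obtain ⟨r, rfl⟩ := Ideal.Quotient.mk_surjective s
      rw [LinearMap.zero_apply, map_zero]
      symm
      exact Ideal.Quotient.eq_zero_iff_mem.2 (Ideal.mul_mem_right r _ ha)
  | succ n ih =>
    have hex : Function.Exact (LinearMap.range (f (n+1))).subtype (f n).rangeRestrict := by
      rw [LinearMap.exact_iff, Submodule.range_subtype, LinearMap.ker_rangeRestrict]
      exact LinearMap.exact_iff.1 (hf n)
    obtain ⟨ih1, ih2⟩ := ih (m + 1) (by convert hpd using 1; omega)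
    constructor
    · exact aux_pd_step R _ _ _ _ _ (Submodule.subtype_injective _)
        (LinearMap.surjective_rangeRestrict _) hex m ih1
    · intro a ha
      obtain ⟨τ, hτ⟩ := ih2 a ha
      obtain ⟨τ', hτ'⟩ := Module.projective_lifting_property _ τ
        (LinearMap.surjective_rangeRestrict (f n))
      refine aux_tau R _ _ _ _ (f n).rangeRestrict (Submodule.subtype_injective _) hex a
        (τ' ∘ₗ (LinearMap.range (f n)).subtype) ?_
      intro s
      rw [← hτ s]
      exact LinearMap.congr_fun hτ' _


/-- Let `(R,𝔪,k)` be a regular Noetherian local ring of dimension `d ≥ 1`.  Then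
`Ext¹_R(Ω^{d-1} k, R)^μ = 0`: every short exact sequence `0 → R → X → Ω^{d-1} k → 0`
of finitely generated modules with `μ(X) = μ(R) + μ(Ω^{d-1} k)` splits. -/
theorem stmt5 (R : Type) [CommRing R] [IsLocalRing R] [IsNoetherianRing R]
    (hreg : IsRegularLocal R)
    (d : ℕ) (hd : 1 ≤ d) (hdim : ringKrullDim R = d)
    (S : Type) [AddCommGroup S] [Module R S] [Module.Finite R S]
    (hS : IsMinSyzygyOfResidueField R (d - 1) S) :
    ∀ (X : Type) [AddCommGroup X] [Module R X] [Module.Finite R X]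
      (f : R →ₗ[R] X) (g : X →ₗ[R] S),
      Function.Injective f → Function.Surjective g → Function.Exact f g →
      mu R X = mu R R + mu R S →
      ∃ s : S →ₗ[R] X, g ∘ₗ s = LinearMap.id := by
  intro X _ _ _ φ g hφ hg hφg hmu
  obtain ⟨n, x, hx, hn⟩ := hreg
  have hnd : n = d := by
    rw [hn] at hdim
    exact Nat.cast_injective hdim
  subst hnd
  obtain ⟨-, rs, hrs, hof, hlen⟩ := aux_reg n R x hx hn
  have hpd := aux_pd_k R n rs hrs hof hlen
  have h1 := aux_mu R S X φ g hg hφg hmu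
  obtain ⟨b, f, ε, hε, h0, hf, -, hmin, hS⟩ := hS
  obtain ⟨N, rfl⟩ : ∃ N, n = N + 1 := ⟨n - 1, by omega⟩
  obtain ⟨hK, hτ⟩ := aux_res R b f ε hε h0 hf N 0 hpd
  have hproj : Module.Projective R (LinearMap.range (f N)) := by
    have := (CategoryTheory.projective_iff_hasProjectiveDimensionLT_one
      (X := ModuleCat.of R (LinearMap.range (f N)))).2 hK
    exact (IsProjective.iff_projective (LinearMap.range (f N))).2 this
  have hmin' : LinearMap.range (LinearMap.range (f N)).subtype ≤
      maximalIdeal R • (⊤ : Submodule R (Fin (b N) → R)) := by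
    rw [Submodule.range_subtype]; exact hmin N
  rcases hS with ⟨hN, ⟨e⟩⟩ | ⟨j, hj, ⟨e⟩⟩
  · obtain rfl : N = 0 := by omega
    refine aux_main R _ S _ (LinearMap.range (f 0)).subtype (e.symm.toLinearMap ∘ₗ ε) ?_ ?_ hmin' hτ
      X φ g hφ hg hφg h1
    · exact e.symm.surjective.comp hε
    · rw [LinearMap.exact_iff, Submodule.range_subtype, LinearEquiv.ker_comp]
      exact LinearMap.exact_iff.1 h0
  · obtain rfl : N = j + 1 := by omega
    refine aux_main R _ S _ (LinearMap.range (f (j+1))).subtype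
      (e.symm.toLinearMap ∘ₗ (f j).rangeRestrict) ?_ ?_ hmin' hτ
      X φ g hφ hg hφg h1
    · exact e.symm.surjective.comp (LinearMap.surjective_rangeRestrict _)
    · rw [LinearMap.exact_iff, Submodule.range_subtype, LinearEquiv.ker_comp,
        LinearMap.ker_rangeRestrict]
      exact LinearMap.exact_iff.1 (hf j)
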